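/- arXiv:2510.09544 — 3 statements merged into one kernel-verified Lean document; each statement's English description precedes it below -/
import Mathlib

section
/- (Fano-type entropy upper bound.) Let α be a finite type with m ≥ 2 elements and let p be a probability mass function on α with maximal atom p_max = max_x p(x). Then H(p) ≤ H_b(p_max) + (1 − p_max)·log(m − 1). -/
open Real

/-- Shannon entropy of a probability mass function on a finite type,
using the natural logarithm and the convention `0 * log 0 = 0`. -/
noncomputable def entropy {α : Type*} [Fintype α] (p : α → ℝ) : ℝ :=
  -∑ x, p x * Real.log (p x)

/-- The binary entropy function `H_b(t) = -t·log t - (1-t)·log(1-t)`. -/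
noncomputable def binEnt (t : ℝ) : ℝ :=
  -(t * Real.log t) - (1 - t) * Real.log (1 - t)

/-- Jensen's inequality: among nonnegative families on `s` with a given sum, the constant one
maximizes the entropy. -/
theorem sum_negMulLog_le {ι : Type*} {s : Finset ι} (hs : s.Nonempty) {f : ι → ℝ}
    (hf : ∀ i ∈ s, 0 ≤ f i) :
    ∑ i ∈ s, negMulLog (f i) ≤ negMulLog (∑ i ∈ s, f i) + (∑ i ∈ s, f i) * log s.card := by
  have hn : (0 : ℝ) < s.card := by exact_mod_cast hs.card_pos
  have jensen := concaveOn_negMulLog.le_map_sum (t := s) (w := fun _ ↦ (s.card : ℝ)⁻¹) (p := f)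
    (fun _ _ ↦ by positivity) (by simp [hn.ne']) hf
  simp only [smul_eq_mul, ← Finset.mul_sum, negMulLog_mul] at jensen
  have hinv : negMulLog (s.card : ℝ)⁻¹ = (s.card : ℝ)⁻¹ * log s.card := by
    simp [negMulLog]
  rw [hinv] at jensen
  refine le_of_mul_le_mul_left ?_ (inv_pos.mpr hn)
  linarith

/-- Fano-type entropy upper bound:
`H(p) ≤ H_b(p_max) + (1 - p_max) · log (m - 1)` where `m = |α| ≥ 2`. -/
theorem entropy_le_fano_bound
    {α : Type*} [Fintype α] (hm : 2 ≤ Fintype.card α)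
    (p : α → ℝ) (hp0 : ∀ x, 0 ≤ p x) (hp1 : ∑ x, p x = 1) :
    entropy p ≤ binEnt (⨆ x, p x) +
      (1 - (⨆ x, p x)) * Real.log ((Fintype.card α : ℝ) - 1) := by
  classical
  have : Nonempty α := Fintype.card_pos_iff.mp (by omega)
  obtain ⟨a, ha⟩ := exists_eq_ciSup_of_finite (f := p)
  rw [← ha]
  have hcard : (Finset.univ.erase a).card = Fintype.card α - 1 := by
    rw [Finset.card_erase_of_mem (Finset.mem_univ a), Finset.card_univ]
  have hne : (Finset.univ.erase a).Nonempty := Finset.card_pos.mp (by omega)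
  have hsum : ∑ x ∈ Finset.univ.erase a, p x = 1 - p a := by
    rw [← hp1, ← Finset.add_sum_erase _ p (Finset.mem_univ a)]
    ring
  have key := sum_negMulLog_le hne fun x _ ↦ hp0 x
  rw [hsum, hcard, Nat.cast_sub (by omega), Nat.cast_one] at key
  rw [entropy, binEnt, ← Finset.add_sum_erase _ _ (Finset.mem_univ a)]
  simp only [negMulLog_eq_neg, Finset.sum_neg_distrib] at key
  linarith
end

section
/- Let α be a finite type with m ≥ 2 elements, let p be a probability mass function on α with maximal atom p_max = max_x p(x), and let C be a constant with 1/2 ≤ C ≤ 1. If p_max ≥ C, then H(p) ≤ H_b(C) + (1 − C)·log(m − 1). -/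
open Real

theorem binEnt_eq_binEntropy (t : ℝ) : binEnt t = binEntropy t := by
  simp only [binEnt, binEntropy, log_inv]
  ring

theorem antitoneOn_binEntropy_add_one_sub_mul {b : ℝ} (hb : 0 ≤ b) :
    AntitoneOn (fun t => binEntropy t + (1 - t) * b) (Set.Icc 2⁻¹ 1) := fun _ hs _ ht hst =>
  add_le_add (binEntropy_strictAntiOn.antitoneOn hs ht hst) (by gcongr)

/-- Fano's bound, with an arbitrary atom `a` in place of the maximal one. -/
theorem entropy_le_binEntropy_add {α : Type*} [Fintype α] (hm : 2 ≤ Fintype.card α)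
    {p : α → ℝ} (hp0 : ∀ x, 0 ≤ p x) (hp1 : ∑ x, p x = 1) (a : α) :
    entropy p ≤ binEntropy (p a) + (1 - p a) * log ((Fintype.card α : ℝ) - 1) := by
  classical
  have hcard : (Finset.univ.erase a).card = Fintype.card α - 1 := by
    rw [Finset.card_erase_of_mem (Finset.mem_univ a), Finset.card_univ]
  have hrest : ∑ x ∈ Finset.univ.erase a, p x = 1 - p a := by
    rw [Finset.sum_erase_eq_sub (Finset.mem_univ a), hp1]
  have hJ := sum_negMulLog_le (s := Finset.univ.erase a) (f := p)
    (Finset.card_pos.mp (by omega)) (fun x _ => hp0 x)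
  rw [hrest, hcard, Nat.cast_sub (by omega), Nat.cast_one] at hJ
  have hsplit : entropy p = negMulLog (p a) + ∑ x ∈ Finset.univ.erase a, negMulLog (p x) := by
    rw [Finset.add_sum_erase _ (fun x => negMulLog (p x)) (Finset.mem_univ a)]
    simp [entropy, negMulLog]
  rw [hsplit, binEntropy_eq_negMulLog_add_negMulLog_one_sub]
  linarith

/-- If the maximal atom `p_max = ⨆ x, p x` satisfies `p_max ≥ C` with
`1/2 ≤ C ≤ 1`, then `H(p) ≤ H_b(C) + (1 - C)·log(m - 1)` where `m = |α| ≥ 2`. -/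
theorem entropy_le_fano_bound_of_pmax_ge
    {α : Type*} [Fintype α] (hm : 2 ≤ Fintype.card α)
    (p : α → ℝ) (hp0 : ∀ x, 0 ≤ p x) (hp1 : ∑ x, p x = 1)
    (C : ℝ) (hC0 : 1 / 2 ≤ C) (hC1 : C ≤ 1)
    (hmax : C ≤ ⨆ x, p x) :
    entropy p ≤ binEnt C + (1 - C) * Real.log ((Fintype.card α : ℝ) - 1) := by
  have : Nonempty α := Fintype.card_pos_iff.mp (by omega)
  obtain ⟨a, ha⟩ := exists_eq_ciSup_of_finite (f := p)
  rw [← ha] at hmax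
  have ha1 : p a ≤ 1 := hp1 ▸ Finset.single_le_sum (fun x _ => hp0 x) (Finset.mem_univ a)
  have hlog : 0 ≤ log ((Fintype.card α : ℝ) - 1) := by
    have : (2 : ℝ) ≤ Fintype.card α := by exact_mod_cast hm
    exact log_nonneg (by linarith)
  rw [one_div] at hC0
  rw [binEnt_eq_binEntropy]
  exact (entropy_le_binEntropy_add hm hp0 hp1 a).trans
    (antitoneOn_binEntropy_add_one_sub_mul hlog ⟨hC0, hC1⟩ ⟨hC0.trans hmax, ha1⟩ hmax)
end

section
/- Let α be a finite type with m ≥ 2 elements, let p be a probability mass function on α with maximal atom p_max = max_x p(x), and let C be a constant with 1/2 ≤ C ≤ 1. If p_max ≥ C, then the entropy deficit from the maximal value satisfies log m − H(p) ≥ C·log(m − 1) − H_b(C); in particular the entropy of a distribution with a persistent high-probability atom is bounded away from the maximal entropy log m. -/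
open Real

/-- The pointwise form of Gibbs' inequality. -/
theorem mul_log_add_sub_le_mul_log {a b : ℝ} (ha : 0 ≤ a) (hb : 0 < b) :
    a * Real.log b + a - b ≤ a * Real.log a := by
  rcases ha.eq_or_lt with rfl | ha
  · simpa using hb.le
  · have h := mul_le_mul_of_nonneg_left (Real.log_le_sub_one_of_pos (div_pos hb ha)) ha.le
    rw [Real.log_div hb.ne' ha.ne', mul_sub, mul_sub, mul_div_cancel₀ _ ha.ne'] at h
    linarith

/-- Grouping bound: an atom of mass at least `C ≥ 1/2` forces `H(p) ≤ H_b(C) + (1-C)·log(m-1)`. -/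
theorem entropy_le_binEnt_add {α : Type*} [Fintype α] (hm : 2 ≤ Fintype.card α)
    (p : α → ℝ) (hp0 : ∀ x, 0 ≤ p x) (hp1 : ∑ x, p x = 1)
    (C : ℝ) (hC0 : 1 / 2 ≤ C) (hC1 : C ≤ 1) (a : α) (ha : C ≤ p a) :
    entropy p ≤ binEnt C + (1 - C) * Real.log ((Fintype.card α : ℝ) - 1) := by
  classical
  have hm' : (2 : ℝ) ≤ Fintype.card α := by exact_mod_cast hm
  have hlog : 0 ≤ Real.log ((Fintype.card α : ℝ) - 1) := Real.log_nonneg (by linarith)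
  have hsum : p a + ∑ x ∈ Finset.univ.erase a, p x = 1 := by
    rw [Finset.add_sum_erase _ _ (Finset.mem_univ a), hp1]
  have hcard : ((Finset.univ.erase a).card : ℝ) = (Fintype.card α : ℝ) - 1 := by
    rw [Finset.card_erase_of_mem (Finset.mem_univ a), Finset.card_univ,
      Nat.cast_sub (by omega), Nat.cast_one]
  have hent : entropy p =
      -(p a * Real.log (p a) + ∑ x ∈ Finset.univ.erase a, p x * Real.log (p x)) := by
    rw [entropy, Finset.add_sum_erase _ (fun x => p x * Real.log (p x)) (Finset.mem_univ a)]
  rcases hC1.eq_or_lt with rfl | hC1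
  · have hrest : ∑ x ∈ Finset.univ.erase a, p x = 0 :=
      le_antisymm (by linarith) (Finset.sum_nonneg fun x _ => hp0 x)
    have hzero := (Finset.sum_eq_zero_iff_of_nonneg fun x _ => hp0 x).1 hrest
    have hpa : p a = 1 := by linarith
    have hterms : ∑ x ∈ Finset.univ.erase a, p x * Real.log (p x) = 0 :=
      Finset.sum_eq_zero fun x hx => by simp [hzero x hx]
    simp [hent, hterms, hpa, binEnt]
  · set r := (1 - C) / ((Fintype.card α : ℝ) - 1) with hr
    have hrpos : 0 < r := div_pos (by linarith) (by linarith)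
    have hatom := mul_log_add_sub_le_mul_log (hp0 a) (by linarith : 0 < C)
    have hothers : ∑ x ∈ Finset.univ.erase a, (p x * Real.log r + p x - r) ≤
        ∑ x ∈ Finset.univ.erase a, p x * Real.log (p x) :=
      Finset.sum_le_sum fun x _ => mul_log_add_sub_le_mul_log (hp0 x) hrpos
    rw [Finset.sum_sub_distrib, Finset.sum_add_distrib, ← Finset.sum_mul, Finset.sum_const,
      nsmul_eq_mul, hcard, hr, mul_div_cancel₀ _ (by linarith),
      Real.log_div (by linarith) (by linarith),
      show ∑ x ∈ Finset.univ.erase a, p x = 1 - p a by linarith] at hothers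
    have hmono : Real.log (1 - C) ≤ Real.log C :=
      Real.log_le_log (by linarith) (by linarith)
    rw [hent, binEnt]
    nlinarith [mul_nonneg (sub_nonneg.2 ha) (sub_nonneg.2 hmono),
      mul_nonneg (sub_nonneg.2 ha) hlog]

/-- If the maximal atom `p_max = ⨆ x, p x` satisfies `p_max ≥ C` with
`1/2 ≤ C ≤ 1`, then the entropy deficit from the maximal value satisfies
`log m - H(p) ≥ C·log(m - 1) - H_b(C)`, where `m = |α| ≥ 2`. -/
theorem entropy_deficit_of_pmax_ge
    {α : Type*} [Fintype α] (hm : 2 ≤ Fintype.card α)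
    (p : α → ℝ) (hp0 : ∀ x, 0 ≤ p x) (hp1 : ∑ x, p x = 1)
    (C : ℝ) (hC0 : 1 / 2 ≤ C) (hC1 : C ≤ 1)
    (hmax : C ≤ ⨆ x, p x) :
    C * Real.log ((Fintype.card α : ℝ) - 1) - binEnt C ≤
      Real.log (Fintype.card α : ℝ) - entropy p := by
  have hm' : (2 : ℝ) ≤ Fintype.card α := by exact_mod_cast hm
  have : Nonempty α := Fintype.card_pos_iff.1 (by omega)
  obtain ⟨a, ha⟩ := exists_eq_ciSup_of_finite (f := p)
  have hent := entropy_le_binEnt_add hm p hp0 hp1 C hC0 hC1 a (ha ▸ hmax)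
  have hlog : Real.log ((Fintype.card α : ℝ) - 1) ≤ Real.log (Fintype.card α : ℝ) :=
    Real.log_le_log (by linarith) (by linarith)
  linarith
end
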